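/- (𝓘-broom lemma) Let M be a small elementary submodel of 𝕄 and 𝓘 an M-invariant ideal on the definable subsets of 𝕄. Suppose α(x,e) ⊢^𝓘 ψ(x,c) ∨ ⋁_{i=1}^N φ_i(x,a_i), where each φ_i(x,a_i) 𝓘-Kim-divides over M and c ⫝ᵘ_M a₁…a_N. Then there are finitely many tuples e₁,…,e_m, each with e_j ≡_M e, such that ⋀_{j=1}^m α(x,e_j) ⊢^𝓘 ψ(x,c). In particular, every formula that 𝓘-Kim-forks over M 𝓘-quasi-divides over M. -/

import Mathlib

/- Common model-theoretic infrastructure for formalizing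
   "NSOP₂ theories are NSOP₁" (arXiv:2206.08512).

   We work with a monster model `𝕄` of a complete theory: a sufficiently
   saturated and strongly homogeneous `L`-structure.  Tuples are functions
   `α → 𝕄`; sets of formulas with parameters are coded via `FmlP`. -/

open FirstOrder Language

universe u v w

namespace NSOP2Paper

/-- A first-order formula in free variables `α ⊕ Fin n` together with an
`n`-tuple of parameters from `𝕄`. -/
abbrev FmlP (L : FirstOrder.Language.{u, u}) (𝕄 : Type u) (α : Type v) :=
  Σ n : ℕ, L.Formula (α ⊕ Fin n) × (Fin n → 𝕄)

/-- `a ≡_C b` : the tuples `a` and `b` satisfy the same formulas with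
parameters from `C`. -/
def EqTpOver (L : FirstOrder.Language.{u, u}) {𝕄 : Type u} [L.Structure 𝕄] (C : Set 𝕄)
    {α : Type v} (a b : α → 𝕄) : Prop :=
  ∀ (n : ℕ) (φ : L.Formula (α ⊕ Fin n)) (c : Fin n → 𝕄), (∀ i, c i ∈ C) →
    (φ.Realize (Sum.elim a c) ↔ φ.Realize (Sum.elim b c))

/-- `tp(a / C)` is finitely satisfiable in `Ms`: every formula over `C`
satisfied by `a` has a realization by a tuple from `Ms`. -/
def FinSatIn (L : FirstOrder.Language.{u, u}) {𝕄 : Type u} [L.Structure 𝕄] (Ms : Set 𝕄)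
    {α : Type v} (a : α → 𝕄) (C : Set 𝕄) : Prop :=
  ∀ (n : ℕ) (φ : L.Formula (α ⊕ Fin n)) (c : Fin n → 𝕄), (∀ i, c i ∈ C) →
    φ.Realize (Sum.elim a c) →
    ∃ m : α → 𝕄, (∀ i, m i ∈ Ms) ∧ φ.Realize (Sum.elim m c)

/-- `Ms` is the underlying set of a (small) elementary submodel of `𝕄`. -/
def IsElemSubmodel (L : FirstOrder.Language.{u, u}) {𝕄 : Type u} [L.Structure 𝕄] (Ms : Set 𝕄) : Prop :=
  ∃ S : L.ElementarySubstructure 𝕄, (S : Set 𝕄) = Ms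

/-- A complete consistent global type (a complete type over the monster `𝕄`)
in variables `α`, coded as the set of formulas-with-parameters it contains. -/
structure GlobalType (L : FirstOrder.Language.{u, u}) (𝕄 : Type u) [L.Structure 𝕄] (α : Type v) where
  carrier : Set (FmlP L 𝕄 α)
  consistent : ∀ t : Finset (FmlP L 𝕄 α), ↑t ⊆ carrier →
    ∃ a : α → 𝕄, ∀ p ∈ t, p.2.1.Realize (Sum.elim a p.2.2)
  complete : ∀ (n : ℕ) (φ : L.Formula (α ⊕ Fin n)) (c : Fin n → 𝕄),
    (⟨n, (φ, c)⟩ : FmlP L 𝕄 α) ∈ carrier ∨ (⟨n, (φ.not, c)⟩ : FmlP L 𝕄 α) ∈ carrier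

variable {L : FirstOrder.Language.{u, u}} {𝕄 : Type u} [L.Structure 𝕄]

/-- The global type `q` is finitely satisfiable in `Ms` (i.e. it is a coheir of
its restriction to `Ms`). -/
def GlobalType.FinSatInM {α : Type v} (q : GlobalType L 𝕄 α) (Ms : Set 𝕄) : Prop :=
  ∀ t : Finset (FmlP L 𝕄 α), ↑t ⊆ q.carrier →
    ∃ m : α → 𝕄, (∀ i, m i ∈ Ms) ∧ ∀ p ∈ t, p.2.1.Realize (Sum.elim m p.2.2)

/-- `a ⊨ q|_C` : the tuple `a` realizes the restriction of the global type `q`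
to parameters from `C`. -/
def RealizesType {α : Type v} (q : GlobalType L 𝕄 α) (a : α → 𝕄) (C : Set 𝕄) : Prop :=
  ∀ (n : ℕ) (φ : L.Formula (α ⊕ Fin n)) (c : Fin n → 𝕄), (∀ i, c i ∈ C) →
    (⟨n, (φ, c)⟩ : FmlP L 𝕄 α) ∈ q.carrier → φ.Realize (Sum.elim a c)

/-- The global type `q` extends `tp(a / C)`. -/
def ExtendsTpOver {α : Type v} (q : GlobalType L 𝕄 α) (C : Set 𝕄) (a : α → 𝕄) : Prop :=
  ∀ (n : ℕ) (φ : L.Formula (α ⊕ Fin n)) (c : Fin n → 𝕄), (∀ i, c i ∈ C) →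
    φ.Realize (Sum.elim a c) → (⟨n, (φ, c)⟩ : FmlP L 𝕄 α) ∈ q.carrier

/-- `B` is a coheir Morley sequence over `Ms` in the global type `q`:
`q` is finitely satisfiable in `Ms` and `B i ⊨ q|_(Ms ∪ B_{<i})`. -/
def MorleyIn {α : Type v} (q : GlobalType L 𝕄 α) (Ms : Set 𝕄) (B : ℕ → α → 𝕄) : Prop :=
  q.FinSatInM Ms ∧
    ∀ i : ℕ, RealizesType q (B i) (Ms ∪ ⋃ (j : ℕ) (_ : j < i), Set.range (B j))

/-- `B` is a coheir Morley sequence over `Ms`. -/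
def CoheirMorley (L : FirstOrder.Language.{u, u}) {𝕄 : Type u} [L.Structure 𝕄] (Ms : Set 𝕄)
    {α : Type v} (B : ℕ → α → 𝕄) : Prop :=
  ∃ q : GlobalType L 𝕄 α, MorleyIn q Ms B

/-- Flatten an `ℕ`-indexed sequence of `α`-tuples into a single tuple. -/
def flatSeq {α : Type v} (I : ℕ → α → 𝕄) : ℕ × α → 𝕄 := fun p => I p.1 p.2

/-- The sequence `I` is indiscernible over `C`. -/
def IndiscernibleOver (L : FirstOrder.Language.{u, u}) {𝕄 : Type u} [L.Structure 𝕄] (C : Set 𝕄)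
    {α : Type v} (I : ℕ → α → 𝕄) : Prop :=
  ∀ (n : ℕ) (f g : Fin n → ℕ), StrictMono f → StrictMono g →
    EqTpOver L C (fun p : Fin n × α => I (f p.1) p.2) (fun p : Fin n × α => I (g p.1) p.2)

/-- `𝕄` is `κ`-saturated: every finitely satisfiable set of formulas in fewer
than `κ` variables over a parameter set of size `< κ` is realized in `𝕄`. -/
def IsSaturated (L : FirstOrder.Language.{u, u}) (𝕄 : Type u) [L.Structure 𝕄] (κ : Cardinal.{u}) : Prop :=
  ∀ (α : Type u) (A : Set 𝕄), Cardinal.mk α < κ → Cardinal.mk A < κ →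
    ∀ Γ : Set (FmlP L 𝕄 α), (∀ p ∈ Γ, ∀ i, p.2.2 i ∈ A) →
      (∀ t : Finset (FmlP L 𝕄 α), ↑t ⊆ Γ →
        ∃ a : α → 𝕄, ∀ p ∈ t, p.2.1.Realize (Sum.elim a p.2.2)) →
      ∃ a : α → 𝕄, ∀ p ∈ Γ, p.2.1.Realize (Sum.elim a p.2.2)

/-- `𝕄` is strongly `κ`-homogeneous: partial elementary maps between tuples of
length `< κ` extend to automorphisms of `𝕄`. -/
def IsStronglyHomogeneous (L : FirstOrder.Language.{u, u}) (𝕄 : Type u) [L.Structure 𝕄]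
    (κ : Cardinal.{u}) : Prop :=
  ∀ (α : Type u), Cardinal.mk α < κ → ∀ a b : α → 𝕄, EqTpOver L (∅ : Set 𝕄) a b →
    ∃ σ : 𝕄 ≃[L] 𝕄, ∀ i, σ (a i) = b i

/-- `𝕄` is a monster model (for smallness degree `κ`): sufficiently saturated
and strongly homogeneous. -/
def IsMonster (L : FirstOrder.Language.{u, u}) (𝕄 : Type u) [L.Structure 𝕄] (κ : Cardinal.{u}) : Prop :=
  Cardinal.aleph0 < κ ∧ IsSaturated L 𝕄 κ ∧ IsStronglyHomogeneous L 𝕄 κ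

/-! ### Tree combinatorics -/

/-- The meet (longest common prefix) of two finite sequences. -/
def meet {A : Type w} [DecidableEq A] : List A → List A → List A
  | a :: as, b :: bs => if a = b then a :: meet as bs else []
  | _, _ => []

/-- The meet of `η 0, …, η i`. -/
def combMeet {A : Type w} [DecidableEq A] {k : ℕ} (η : Fin k → List A) (i : Fin k) : List A :=
  (List.ofFn fun j : Fin i.val => η (Fin.castLE i.2.le j)).foldl meet (η i)

/-- `η 0, …, η (k-1)` is a descending comb: a lexicographically increasing
antichain such that the meet of `η 0, …, η (i+1)` is a proper initial segment
of the meet of `η 0, …, η i`. -/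
def DescendingComb {A : Type w} [DecidableEq A] [LT A] {k : ℕ} (η : Fin k → List A) : Prop :=
  (∀ i j : Fin k, i ≠ j → ¬ η i <+: η j) ∧
  (∀ i j : Fin k, i < j → List.Lex (· < ·) (η i) (η j)) ∧
  (∀ (i : ℕ) (h : i + 1 < k),
    combMeet η ⟨i + 1, h⟩ <+: combMeet η ⟨i, by omega⟩ ∧
    combMeet η ⟨i + 1, h⟩ ≠ combMeet η ⟨i, by omega⟩)

/-! ### Tree properties of theories (witnessed in the monster model) -/

/-- `T = Th(𝕄)` has `SOP₁`. -/
def HasSOP1 (L : FirstOrder.Language.{u, u}) (𝕄 : Type u) [L.Structure 𝕄] : Prop :=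
  ∃ (k m : ℕ) (φ : L.Formula (Fin k ⊕ Fin m)) (b : List Bool → Fin m → 𝕄),
    (∀ σ : ℕ → Bool, ∃ a : Fin k → 𝕄,
      ∀ n : ℕ, φ.Realize (Sum.elim a (b (List.ofFn fun i : Fin n => σ i)))) ∧
    ∀ η₁ η₂ : List Bool, (η₁ ++ [false]) <+: η₂ →
      ¬ ∃ a : Fin k → 𝕄, φ.Realize (Sum.elim a (b η₂)) ∧
        φ.Realize (Sum.elim a (b (η₁ ++ [true])))

/-- `T = Th(𝕄)` has `SOP₂`. -/
def HasSOP2 (L : FirstOrder.Language.{u, u}) (𝕄 : Type u) [L.Structure 𝕄] : Prop :=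
  ∃ (k m : ℕ) (φ : L.Formula (Fin k ⊕ Fin m)) (b : List Bool → Fin m → 𝕄),
    (∀ σ : ℕ → Bool, ∃ a : Fin k → 𝕄,
      ∀ n : ℕ, φ.Realize (Sum.elim a (b (List.ofFn fun i : Fin n => σ i)))) ∧
    ∀ η₁ η₂ : List Bool, ¬ η₁ <+: η₂ → ¬ η₂ <+: η₁ →
      ¬ ∃ a : Fin k → 𝕄, φ.Realize (Sum.elim a (b η₁)) ∧ φ.Realize (Sum.elim a (b η₂))

/-- `T = Th(𝕄)` has `k`-`DCTP₁`: paths are consistent but descending combs of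
size `k` are inconsistent. -/
def HasKDCTP1 (L : FirstOrder.Language.{u, u}) (𝕄 : Type u) [L.Structure 𝕄] (k : ℕ) : Prop :=
  ∃ (r m : ℕ) (φ : L.Formula (Fin r ⊕ Fin m)) (b : List ℕ → Fin m → 𝕄),
    (∀ σ : ℕ → ℕ, ∃ a : Fin r → 𝕄,
      ∀ n : ℕ, φ.Realize (Sum.elim a (b (List.ofFn fun i : Fin n => σ i)))) ∧
    ∀ η : Fin k → List ℕ, DescendingComb η →
      ¬ ∃ a : Fin r → 𝕄, ∀ i, φ.Realize (Sum.elim a (b (η i)))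

/-- `T = Th(𝕄)` has weak `k`-`TP₁`: paths are consistent but any `k` pairwise
incomparable nodes with common pairwise meet are inconsistent. -/
def HasWeakKTP1 (L : FirstOrder.Language.{u, u}) (𝕄 : Type u) [L.Structure 𝕄] (k : ℕ) : Prop :=
  ∃ (r m : ℕ) (φ : L.Formula (Fin r ⊕ Fin m)) (b : List ℕ → Fin m → 𝕄),
    (∀ σ : ℕ → ℕ, ∃ a : Fin r → 𝕄,
      ∀ n : ℕ, φ.Realize (Sum.elim a (b (List.ofFn fun i : Fin n => σ i)))) ∧
    ∀ η : Fin k → List ℕ,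
      (∀ i j, i ≠ j → ¬ η i <+: η j) →
      (∀ i j i' j' : Fin k, i ≠ j → i' ≠ j' → meet (η i) (η j) = meet (η i') (η j')) →
      ¬ ∃ a : Fin r → 𝕄, ∀ i, φ.Realize (Sum.elim a (b (η i)))

/-- `T = Th(𝕄)` has `k`-`DCTP₂`: paths are `k`-inconsistent but descending
combs are consistent. -/
def HasKDCTP2 (L : FirstOrder.Language.{u, u}) (𝕄 : Type u) [L.Structure 𝕄] (k : ℕ) : Prop :=
  ∃ (r m : ℕ) (φ : L.Formula (Fin r ⊕ Fin m)) (b : List Bool → Fin m → 𝕄),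
    (∀ σ : ℕ → Bool, ∀ s : Finset ℕ, s.card = k →
      ¬ ∃ a : Fin r → 𝕄, ∀ n ∈ s,
        φ.Realize (Sum.elim a (b (List.ofFn fun i : Fin n => σ i)))) ∧
    ∀ (l : ℕ) (η : Fin l → List Bool), DescendingComb η →
      ∃ a : Fin r → 𝕄, ∀ i, φ.Realize (Sum.elim a (b (η i)))

/-! ### Kim-dividing and Conant-dividing, with respect to coheir Morley sequences -/

/-- `φ(x, b)` Kim-divides over `Ms`: some coheir Morley sequence over `Ms`
starting with `b` makes it inconsistent. -/
def KimDivides (L : FirstOrder.Language.{u, u}) {𝕄 : Type u} [L.Structure 𝕄] (Ms : Set 𝕄)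
    {α : Type v} {n : ℕ} (φ : L.Formula (α ⊕ Fin n)) (b : Fin n → 𝕄) : Prop :=
  ∃ B : ℕ → Fin n → 𝕄, CoheirMorley L Ms B ∧ B 0 = b ∧
    ¬ ∃ a : α → 𝕄, ∀ i, φ.Realize (Sum.elim a (B i))

/-- `φ(x, b)` Kim-forks over `Ms`: it implies a finite disjunction of formulas
Kim-dividing over `Ms`. -/
def KimForks (L : FirstOrder.Language.{u, u}) {𝕄 : Type u} [L.Structure 𝕄] (Ms : Set 𝕄)
    {α : Type v} {n : ℕ} (φ : L.Formula (α ⊕ Fin n)) (b : Fin n → 𝕄) : Prop :=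
  ∃ (N : ℕ) (m : Fin N → ℕ) (ψ : ∀ j : Fin N, L.Formula (α ⊕ Fin (m j)))
    (c : ∀ j : Fin N, Fin (m j) → 𝕄),
    (∀ j, KimDivides L Ms (ψ j) (c j)) ∧
    ∀ a : α → 𝕄, φ.Realize (Sum.elim a b) → ∃ j, (ψ j).Realize (Sum.elim a (c j))

/-- `φ(x, b)` Conant-divides over `Ms`: every coheir Morley sequence over `Ms`
starting with `b` makes it inconsistent. -/
def ConantDivides (L : FirstOrder.Language.{u, u}) {𝕄 : Type u} [L.Structure 𝕄] (Ms : Set 𝕄)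
    {α : Type v} {n : ℕ} (φ : L.Formula (α ⊕ Fin n)) (b : Fin n → 𝕄) : Prop :=
  ∀ B : ℕ → Fin n → 𝕄, CoheirMorley L Ms B → B 0 = b →
    ¬ ∃ a : α → 𝕄, ∀ i, φ.Realize (Sum.elim a (B i))

/-- `φ(x, b)` Conant-forks over `Ms`. -/
def ConantForks (L : FirstOrder.Language.{u, u}) {𝕄 : Type u} [L.Structure 𝕄] (Ms : Set 𝕄)
    {α : Type v} {n : ℕ} (φ : L.Formula (α ⊕ Fin n)) (b : Fin n → 𝕄) : Prop :=
  ∃ (N : ℕ) (m : Fin N → ℕ) (ψ : ∀ j : Fin N, L.Formula (α ⊕ Fin (m j)))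
    (c : ∀ j : Fin N, Fin (m j) → 𝕄),
    (∀ j, ConantDivides L Ms (ψ j) (c j)) ∧
    ∀ a : α → 𝕄, φ.Realize (Sum.elim a b) → ∃ j, (ψ j).Realize (Sum.elim a (c j))

/-- `a ⫝^{K*}_{Ms} b` : `tp(a/Ms b)` contains no formula Conant-forking
over `Ms`. -/
def ConantIndep (L : FirstOrder.Language.{u, u}) {𝕄 : Type u} [L.Structure 𝕄] (Ms : Set 𝕄)
    {α : Type v} {β : Type w} (a : α → 𝕄) (b : β → 𝕄) : Prop :=
  ∀ (n : ℕ) (φ : L.Formula (α ⊕ Fin n)) (d : Fin n → 𝕄),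
    (∀ i, d i ∈ Ms ∪ Set.range b) → φ.Realize (Sum.elim a d) →
    ¬ ConantForks L Ms φ d

/-! ### Abstract independence relations between sets over models -/

/-- An abstract ternary relation `A ⫝_M B` between subsets of `𝕄` over
(elementary submodels of) `𝕄`. -/
structure IndRel (L : FirstOrder.Language.{u, u}) (𝕄 : Type u) [L.Structure 𝕄] where
  rel : Set 𝕄 → Set 𝕄 → Set 𝕄 → Prop

/-- A set `S` of `α`-tuples is type-definable over `C`. -/
def TypeDefinableOver (L : FirstOrder.Language.{u, u}) {𝕄 : Type u} [L.Structure 𝕄] (C : Set 𝕄)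
    {γ : Type v} (S : Set (γ → 𝕄)) : Prop :=
  ∃ Γ : Set (FmlP L 𝕄 γ), (∀ p ∈ Γ, ∀ i, p.2.2 i ∈ C) ∧
    ∀ g : γ → 𝕄, g ∈ S ↔ ∀ p ∈ Γ, p.2.1.Realize (Sum.elim g p.2.2)

namespace IndRel


/-- Invariance under automorphisms of `𝕄`. -/
def Invariant (R : IndRel L 𝕄) : Prop :=
  ∀ (σ : 𝕄 ≃[L] 𝕄) (A Ms B : Set 𝕄), R.rel A Ms B →
    R.rel ((⇑σ) '' A) ((⇑σ) '' Ms) ((⇑σ) '' B)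

/-- Monotonicity (on both sides). -/
def Mono (R : IndRel L 𝕄) : Prop :=
  ∀ (A A' Ms B B' : Set 𝕄), IsElemSubmodel L Ms → R.rel A Ms B →
    Ms ⊆ A' → A' ⊆ A → Ms ⊆ B' → B' ⊆ B → R.rel A' Ms B'

/-- Existence: for `M ⊆ A, B` there is `A' ≡_M A` with `A' ⫝_M B`. -/
def Existence (R : IndRel L 𝕄) (κ : Cardinal.{u}) : Prop :=
  ∀ (Ms : Set 𝕄), IsElemSubmodel L Ms → Cardinal.mk Ms < κ →
    ∀ (α β : Type u), Cardinal.mk α < κ → Cardinal.mk β < κ →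
      ∀ (a : α → 𝕄) (b : β → 𝕄),
        ∃ a' : α → 𝕄, EqTpOver L Ms a' a ∧
          R.rel (Ms ∪ Set.range a') Ms (Ms ∪ Set.range b)

/-- Right extension. -/
def RightExt (R : IndRel L 𝕄) (κ : Cardinal.{u}) : Prop :=
  ∀ (Ms : Set 𝕄), IsElemSubmodel L Ms → Cardinal.mk Ms < κ →
    ∀ (α : Type u), Cardinal.mk α < κ → ∀ (a : α → 𝕄) (B C : Set 𝕄),
      Cardinal.mk B < κ → Cardinal.mk C < κ →
      R.rel (Set.range a) Ms B → B ⊆ C →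
      ∃ a' : α → 𝕄, EqTpOver L B a' a ∧ R.rel (Set.range a') Ms C

/-- Quasi-strong finite character: for complete types `p = tp(a₀/Ms)` and
`q = tp(b₀/Ms)`, the set of pairs of realizations `(a, b)` with `a ⫝_Ms b`
is type-definable over `Ms`. -/
def QSFC (R : IndRel L 𝕄) (κ : Cardinal.{u}) : Prop :=
  ∀ (Ms : Set 𝕄), IsElemSubmodel L Ms → Cardinal.mk Ms < κ →
    ∀ (α β : Type u), Cardinal.mk α < κ → Cardinal.mk β < κ →
      ∀ (a₀ : α → 𝕄) (b₀ : β → 𝕄),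
        TypeDefinableOver L Ms {g : (α ⊕ β) → 𝕄 |
          EqTpOver L Ms (g ∘ Sum.inl) a₀ ∧ EqTpOver L Ms (g ∘ Sum.inr) b₀ ∧
          R.rel (Set.range (g ∘ Sum.inl)) Ms (Set.range (g ∘ Sum.inr))}

/-- The coheir chain condition. -/
def CoheirChain (R : IndRel L 𝕄) (κ : Cardinal.{u}) : Prop :=
  ∀ (Ms : Set 𝕄), IsElemSubmodel L Ms → Cardinal.mk Ms < κ →
    ∀ (α β : Type u), Cardinal.mk α < κ → Cardinal.mk β < κ →
      ∀ (a : α → 𝕄) (b : β → 𝕄), R.rel (Set.range a) Ms (Set.range b) →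
        ∀ I : ℕ → β → 𝕄, CoheirMorley L Ms I → I 0 = b →
          ∃ I' : ℕ → β → 𝕄, EqTpOver L Ms (flatSeq I') (flatSeq I) ∧
            R.rel (Set.range a) Ms (⋃ i, Set.range (I' i)) ∧
            ∀ i, EqTpOver L (Ms ∪ Set.range a) (I' i) b

/-- `R` implies `⫝ʰ` : `A ⫝_M B` implies `tp(B / M A)` is finitely
satisfiable in `M`. -/
def StrongerThanH (R : IndRel L 𝕄) : Prop :=
  ∀ (A Ms B : Set 𝕄), IsElemSubmodel L Ms → R.rel A Ms B →
    FinSatIn L Ms (fun x : B => (x : 𝕄)) (Ms ∪ A)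

end IndRel

/-- The axioms satisfied by the relations among which `⫝^CK` is weakest. -/
def GoodRel (R : IndRel L 𝕄) (κ : Cardinal.{u}) : Prop :=
  R.StrongerThanH ∧ R.Invariant ∧ R.Mono ∧ R.Existence κ ∧ R.RightExt κ ∧ R.CoheirChain κ

/-- `R` is `⫝^CK` : the weakest relation implying `⫝ʰ` and satisfying
invariance, monotonicity, existence, right extension and the coheir chain
condition. -/
def IsCK (R : IndRel L 𝕄) (κ : Cardinal.{u}) : Prop :=
  GoodRel R κ ∧ ∀ R' : IndRel L 𝕄, GoodRel R' κ →
    ∀ A Ms B : Set 𝕄, R'.rel A Ms B → R.rel A Ms B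

/-- `q` is a canonical global type over `Ms` (w.r.t. the relation `R = ⫝^CK`):
whenever `c ⊨ q|_{Ms b}` we have `b ⫝^CK_{Ms} c`. -/
def IsCanonicalGlobal (R : IndRel L 𝕄) (κ : Cardinal.{u}) (Ms : Set 𝕄) {α : Type v}
    (q : GlobalType L 𝕄 α) : Prop :=
  ∀ (β : Type u), Cardinal.mk β < κ → ∀ (b : β → 𝕄) (c : α → 𝕄),
    RealizesType q c (Ms ∪ Set.range b) → R.rel (Set.range b) Ms (Set.range c)

/-- A canonical Morley sequence over `Ms`: a coheir Morley sequence in a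
canonical coheir. -/
def CanonicalMorley (R : IndRel L 𝕄) (κ : Cardinal.{u}) (Ms : Set 𝕄) {α : Type v}
    (I : ℕ → α → 𝕄) : Prop :=
  ∃ q : GlobalType L 𝕄 α, IsCanonicalGlobal R κ Ms q ∧ MorleyIn q Ms I

/-- `q` is a strong canonical global type over `Ms`. -/
def IsStrongCanonical (R : IndRel L 𝕄) (κ : Cardinal.{u}) (Ms : Set 𝕄) {α : Type v}
    (q : GlobalType L 𝕄 α) : Prop :=
  ∀ (β : Type u), Cardinal.mk β < κ → ∀ (b : β → 𝕄) (c : α → 𝕄),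
    RealizesType q c (Ms ∪ Set.range b) →
    ∀ (γ : Type u), Cardinal.mk γ < κ → ∀ (a : γ → 𝕄),
      ∃ a' : γ → 𝕄, EqTpOver L (Ms ∪ Set.range c) a' a ∧
        ∃ q' : GlobalType L 𝕄 (γ ⊕ α), IsCanonicalGlobal R κ Ms q' ∧
          ExtendsTpOver q' (Ms ∪ Set.range b) (Sum.elim a' c)

/-! ### `M`-invariant ideals and `𝓘`-Kim-dividing -/

/-- An `Ms`-invariant ideal on the definable subsets of `𝕄` (in variables `α`). -/
structure InvIdeal (L : FirstOrder.Language.{u, u}) (𝕄 : Type u) [L.Structure 𝕄] (Ms : Set 𝕄)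
    (α : Type v) where
  mem : Set (α → 𝕄) → Prop
  definable_of_mem : ∀ S, mem S → ∃ (n : ℕ) (ψ : L.Formula (α ⊕ Fin n)) (c : Fin n → 𝕄),
    S = {a : α → 𝕄 | ψ.Realize (Sum.elim a c)}
  union_mem : ∀ S T, mem S → mem T → mem (S ∪ T)
  subset_mem : ∀ S T, mem S →
    (∃ (n : ℕ) (ψ : L.Formula (α ⊕ Fin n)) (c : Fin n → 𝕄),
      T = {a : α → 𝕄 | ψ.Realize (Sum.elim a c)}) →
    T ⊆ S → mem T
  invariant : ∀ σ : 𝕄 ≃[L] 𝕄, (∀ x ∈ Ms, σ x = x) → ∀ S, mem S →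
    mem ((fun a => (⇑σ) ∘ a) '' S)

/-- `φ(x, b)` `𝓘`-Kim-divides over `Ms`. -/
def IKimDivides {Ms : Set 𝕄} {α : Type v} (I : InvIdeal L 𝕄 Ms α) {n : ℕ}
    (φ : L.Formula (α ⊕ Fin n)) (b : Fin n → 𝕄) : Prop :=
  ∃ (B : ℕ → Fin n → 𝕄) (k : ℕ), CoheirMorley L Ms B ∧ B 0 = b ∧ 0 < k ∧
    ∀ s : Finset ℕ, s.card = k →
      I.mem {a : α → 𝕄 | ∀ i ∈ s, φ.Realize (Sum.elim a (B i))}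

/-- `φ(x, b)` `𝓘`-Kim-forks over `Ms`. -/
def IKimForks {Ms : Set 𝕄} {α : Type v} (I : InvIdeal L 𝕄 Ms α) {n : ℕ}
    (φ : L.Formula (α ⊕ Fin n)) (b : Fin n → 𝕄) : Prop :=
  ∃ (N : ℕ) (m : Fin N → ℕ) (ψ : ∀ j : Fin N, L.Formula (α ⊕ Fin (m j)))
    (c : ∀ j : Fin N, Fin (m j) → 𝕄),
    (∀ j, IKimDivides I (ψ j) (c j)) ∧
    ∀ a : α → 𝕄, φ.Realize (Sum.elim a b) → ∃ j, (ψ j).Realize (Sum.elim a (c j))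

/-- `φ(x, b)` `𝓘`-quasi-divides over `Ms`. -/
def IQuasiDivides {Ms : Set 𝕄} {α : Type v} (I : InvIdeal L 𝕄 Ms α) {n : ℕ}
    (φ : L.Formula (α ⊕ Fin n)) (b : Fin n → 𝕄) : Prop :=
  ∃ (mm : ℕ) (b' : Fin mm → Fin n → 𝕄), 0 < mm ∧ (∀ j, EqTpOver L Ms (b' j) b) ∧
    I.mem {a : α → 𝕄 | ∀ j, φ.Realize (Sum.elim a (b' j))}

/-! ### `h^⫝`-inconsistency and the derived relation `⫝'` -/

/-- A family of formulas is `h^⫝`-inconsistent with respect to `P = tp(a₀/Ms)`. -/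
def HInconsistent (R : IndRel L 𝕄) (Ms : Set 𝕄) {α : Type v} (a₀ : α → 𝕄)
    {ι : Type w} (m : ι → ℕ) (φ : ∀ i : ι, L.Formula (α ⊕ Fin (m i)))
    (b : ∀ i : ι, Fin (m i) → 𝕄) : Prop :=
  ¬ ∃ a : α → 𝕄, EqTpOver L Ms a a₀ ∧
      R.rel (Set.range a) Ms (⋃ i, Set.range (b i)) ∧
      ∀ i, (φ i).Realize (Sum.elim a (b i))

/-- A single formula is `h^⫝`-inconsistent with respect to `P = tp(a₀/Ms)`. -/
def HInconsistentSingle (R : IndRel L 𝕄) (Ms : Set 𝕄) {α : Type v} (a₀ : α → 𝕄)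
    {n : ℕ} (φ : L.Formula (α ⊕ Fin n)) (b : Fin n → 𝕄) : Prop :=
  ¬ ∃ a : α → 𝕄, EqTpOver L Ms a a₀ ∧ R.rel (Set.range a) Ms (Set.range b) ∧
      φ.Realize (Sum.elim a b)

/-- `φ(x, b)` `h^⫝`-Kim-divides with respect to `tp(a₀/Ms)`. -/
def HKimDivides (R : IndRel L 𝕄) (Ms : Set 𝕄) {α : Type v} (a₀ : α → 𝕄)
    {n : ℕ} (φ : L.Formula (α ⊕ Fin n)) (b : Fin n → 𝕄) : Prop :=
  ∃ B : ℕ → Fin n → 𝕄, CoheirMorley L Ms B ∧ B 0 = b ∧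
    HInconsistent R Ms a₀ (fun _ : ℕ => n) (fun _ => φ) B

/-- `φ(x, b)` `h^⫝`-Kim-forks with respect to `tp(a₀/Ms)`. -/
def HKimForks (R : IndRel L 𝕄) (Ms : Set 𝕄) {α : Type v} (a₀ : α → 𝕄)
    {n : ℕ} (φ : L.Formula (α ⊕ Fin n)) (b : Fin n → 𝕄) : Prop :=
  ∃ (N : ℕ) (m : Fin N → ℕ) (ψ : ∀ j : Fin N, L.Formula (α ⊕ Fin (m j)))
    (c : ∀ j : Fin N, Fin (m j) → 𝕄),
    (∀ j, HKimDivides R Ms a₀ (ψ j) (c j)) ∧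
    ∀ a : α → 𝕄, φ.Realize (Sum.elim a b) → ∃ j, (ψ j).Realize (Sum.elim a (c j))

/-- `φ(x, b)` `h^⫝`-quasi-divides with respect to `tp(a₀/Ms)`. -/
def HQuasiDivides (R : IndRel L 𝕄) (Ms : Set 𝕄) {α : Type v} (a₀ : α → 𝕄)
    {n : ℕ} (φ : L.Formula (α ⊕ Fin n)) (b : Fin n → 𝕄) : Prop :=
  ∃ (mm : ℕ) (b' : Fin mm → Fin n → 𝕄), 0 < mm ∧ (∀ j, EqTpOver L Ms (b' j) b) ∧
    HInconsistent R Ms a₀ (fun _ : Fin mm => n) (fun _ => φ) b'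

/-- The derived relation `⫝'` on tuples:
`tp(a / Ms b)` contains no formula `h^⫝`-Kim-forking w.r.t. `tp(a/Ms)`. -/
def DerivedIndep (R : IndRel L 𝕄) (Ms : Set 𝕄) {α : Type v} {β : Type w}
    (a : α → 𝕄) (b : β → 𝕄) : Prop :=
  ∀ (n : ℕ) (φ : L.Formula (α ⊕ Fin n)) (d : Fin n → 𝕄),
    (∀ i, d i ∈ Ms ∪ Set.range b) → φ.Realize (Sum.elim a d) →
    ¬ HKimForks R Ms a φ d

/-- The derived relation `⫝'` as a relation between sets over models. -/
def derived (R : IndRel L 𝕄) : IndRel L 𝕄 where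
  rel A Ms B := ∀ (n : ℕ) (φ : L.Formula (↥A ⊕ Fin n)) (d : Fin n → 𝕄),
    (∀ i, d i ∈ Ms ∪ B) → φ.Realize (Sum.elim (fun x : A => (x : 𝕄)) d) →
    ¬ HKimForks R Ms (fun x : A => (x : 𝕄)) φ d

/-! ### Coheir trees -/

/-- The tuple, indexed by extensions, consisting of the part of the tree `c`
lying (weakly) above the node `ν` (where `ν` has length `Lh`). -/
def subtreeTupleLen {α : Type v} {n : ℕ} (c : {l : List ℕ // l.length ≤ n} → α → 𝕄)
    (Lh : ℕ) (ν : List ℕ) (hν : ν.length = Lh) :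
    ({s : List ℕ // Lh + s.length ≤ n} × α) → 𝕄 :=
  fun p => c ⟨ν ++ p.1.1, by rw [List.length_append, hν]; exact p.1.2⟩ p.2

end NSOP2Paper

namespace NSOP2Paper

section Broom

variable {L : FirstOrder.Language.{u, u}} {𝕄 : Type u} [L.Structure 𝕄]

/-! ### Definable sets of tuples -/

/-- `S` is definable over `C` by a formula using elements of `C` as parameters. -/
def DefOver (L : FirstOrder.Language.{u, u}) {𝕄 : Type u} [L.Structure 𝕄] (C : Set 𝕄)
    {β : Type v} (S : Set (β → 𝕄)) : Prop :=
  ∃ φ : L.Formula (β ⊕ C), S = {a | φ.Realize (Sum.elim a (fun x : C => (x : 𝕄)))}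

theorem DefOver.of_formula {C : Set 𝕄} {β : Type v} {n : ℕ} (φ : L.Formula (β ⊕ Fin n))
    (c : Fin n → 𝕄) (hc : ∀ i, c i ∈ C) :
    DefOver L C {a : β → 𝕄 | φ.Realize (Sum.elim a c)} := by
  refine ⟨φ.relabel (Sum.map id fun i => ⟨c i, hc i⟩), ?_⟩
  ext a
  simp only [Set.mem_ofPred_eq, Formula.realize_relabel]
  have h : (Sum.elim a (fun x : C => (x : 𝕄))) ∘ Sum.map id (fun i => (⟨c i, hc i⟩ : C)) =
      Sum.elim a c := by
    funext x; rcases x with x | x <;> rfl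
  rw [h]

theorem DefOver.exists_formula {C : Set 𝕄} {β : Type v} {S : Set (β → 𝕄)} (h : DefOver L C S) :
    ∃ (n : ℕ) (φ : L.Formula (β ⊕ Fin n)) (c : Fin n → 𝕄), (∀ i, c i ∈ C) ∧
      S = {a : β → 𝕄 | φ.Realize (Sum.elim a c)} := by
  classical
  obtain ⟨φ, rfl⟩ := h
  set F : Finset C := φ.freeVarFinset.toRight with hF
  let f : φ.freeVarFinset → β ⊕ Fin F.card := fun x => match x with
    | ⟨Sum.inl b, _⟩ => Sum.inl b
    | ⟨Sum.inr g, hg⟩ => Sum.inr (F.equivFin ⟨g, Finset.mem_toRight.2 hg⟩)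
  refine ⟨F.card, φ.restrictFreeVar f, fun i => ((F.equivFin.symm i : F) : C),
    fun i => ((F.equivFin.symm i : F) : C).2, ?_⟩
  ext a
  simp only [Set.mem_ofPred_eq, Formula.Realize]
  symm
  refine BoundedFormula.realize_restrictFreeVar (φ := φ) (f := f)
    (Sum.elim a (fun x : C => (x : 𝕄))) ?_
  rintro ⟨x | x, hx⟩
  · rfl
  · simp [f]

theorem DefOver.mono {C D : Set 𝕄} {β : Type v} {S : Set (β → 𝕄)} (h : DefOver L C S)
    (hCD : C ⊆ D) : DefOver L D S := by
  obtain ⟨n, φ, c, hc, rfl⟩ := h.exists_formula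
  exact .of_formula φ c fun i => hCD (hc i)

theorem DefOver.compl {C : Set 𝕄} {β : Type v} {S : Set (β → 𝕄)} (h : DefOver L C S) :
    DefOver L C Sᶜ := by
  obtain ⟨φ, rfl⟩ := h
  exact ⟨φ.not, by ext a; simp [Formula.realize_not]⟩

theorem DefOver.inter {C : Set 𝕄} {β : Type v} {S T : Set (β → 𝕄)} (hS : DefOver L C S)
    (hT : DefOver L C T) : DefOver L C (S ∩ T) := by
  obtain ⟨φ, rfl⟩ := hS
  obtain ⟨ψ, rfl⟩ := hT
  exact ⟨φ ⊓ ψ, by ext a; simp [Formula.realize_inf]⟩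

theorem DefOver.union {C : Set 𝕄} {β : Type v} {S T : Set (β → 𝕄)} (hS : DefOver L C S)
    (hT : DefOver L C T) : DefOver L C (S ∪ T) := by
  have := (hS.compl.inter hT.compl).compl
  rwa [Set.compl_inter, _root_.compl_compl, _root_.compl_compl] at this

theorem DefOver.diff {C : Set 𝕄} {β : Type v} {S T : Set (β → 𝕄)} (hS : DefOver L C S)
    (hT : DefOver L C T) : DefOver L C (S \ T) :=
  hS.inter hT.compl

theorem DefOver.univ {C : Set 𝕄} {β : Type v} : DefOver L C (Set.univ : Set (β → 𝕄)) :=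
  ⟨⊤, by ext a; simp⟩

theorem DefOver.biInter {C : Set 𝕄} {β : Type v} {ι : Type w} (t : Finset ι)
    {S : ι → Set (β → 𝕄)} (h : ∀ i ∈ t, DefOver L C (S i)) :
    DefOver L C (⋂ i ∈ t, S i) := by
  classical
  induction t using Finset.induction_on with
  | empty => simpa using DefOver.univ
  | insert i t _ ih =>
    rw [Finset.set_biInter_insert]
    exact (h i (Finset.mem_insert_self i t)).inter
      (ih fun j hj => h j (Finset.mem_insert_of_mem hj))

theorem DefOver.subst {C : Set 𝕄} {β : Type v} {δ : Type w} {S : Set (δ → 𝕄)}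
    (h : DefOver L C S) (f : δ → β ⊕ C) :
    DefOver L C {u : β → 𝕄 | (fun d => Sum.elim u (fun x : C => (x : 𝕄)) (f d)) ∈ S} := by
  obtain ⟨φ, rfl⟩ := h
  refine ⟨φ.relabel (Sum.elim f Sum.inr), ?_⟩
  ext u
  simp only [Set.mem_ofPred_eq, Formula.realize_relabel]
  have h : (Sum.elim u (fun x : C => (x : 𝕄))) ∘ Sum.elim f Sum.inr =
      Sum.elim (fun d => Sum.elim u (fun x : C => (x : 𝕄)) (f d)) (fun x : C => (x : 𝕄)) := by
    funext x; rcases x with x | x <;> rfl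
  rw [h]

theorem DefOver.preimage_comp {C : Set 𝕄} {β : Type v} {δ : Type w} {S : Set (δ → 𝕄)}
    (h : DefOver L C S) (f : δ → β) : DefOver L C {u : β → 𝕄 | u ∘ f ∈ S} :=
  h.subst fun d => Sum.inl (f d)

theorem DefOver.section_left {C : Set 𝕄} {β : Type v} {γ : Type w} {S : Set (β ⊕ γ → 𝕄)}
    (h : DefOver L C S) (v : γ → 𝕄) (hv : ∀ i, v i ∈ C) :
    DefOver L C {u : β → 𝕄 | Sum.elim u v ∈ S} := by
  convert h.subst (Sum.map id fun i => (⟨v i, hv i⟩ : C)) using 4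
  rename_i u
  funext x; rcases x with x | x <;> rfl

theorem DefOver.section_right {C : Set 𝕄} {β : Type v} {γ : Type w} {S : Set (β ⊕ γ → 𝕄)}
    (h : DefOver L C S) (u : β → 𝕄) (hu : ∀ i, u i ∈ C) :
    DefOver L C {v : γ → 𝕄 | Sum.elim u v ∈ S} := by
  convert h.subst (Sum.elim (fun i => Sum.inr (⟨u i, hu i⟩ : C)) Sum.inl) using 4
  rename_i v
  funext x; rcases x with x | x <;> rfl

/-! ### Types and finite satisfiability in terms of definable sets -/

theorem finSatIn_iff {Ms C : Set 𝕄} {β : Type v} {a : β → 𝕄} :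
    FinSatIn L Ms a C ↔ ∀ S : Set (β → 𝕄), DefOver L C S → a ∈ S →
      ∃ m : β → 𝕄, (∀ i, m i ∈ Ms) ∧ m ∈ S := by
  constructor
  · intro h S hS ha
    obtain ⟨n, φ, c, hc, rfl⟩ := hS.exists_formula
    exact h n φ c hc ha
  · intro h n φ c hc ha
    exact h _ (.of_formula φ c hc) ha

theorem eqTpOver_iff {C : Set 𝕄} {β : Type v} {a b : β → 𝕄} :
    EqTpOver L C a b ↔ ∀ S : Set (β → 𝕄), DefOver L C S → a ∈ S → b ∈ S := by
  constructor
  · intro h S hS ha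
    obtain ⟨n, φ, c, hc, rfl⟩ := hS.exists_formula
    exact (h n φ c hc).1 ha
  · intro h n φ c hc
    refine ⟨h _ (.of_formula φ c hc), fun hb => ?_⟩
    by_contra ha
    exact h _ (DefOver.of_formula φ c hc).compl ha hb

theorem EqTpOver.symm {C : Set 𝕄} {β : Type v} {a b : β → 𝕄} (h : EqTpOver L C a b) :
    EqTpOver L C b a :=
  fun n φ c hc => (h n φ c hc).symm

theorem EqTpOver.trans {C : Set 𝕄} {β : Type v} {a b d : β → 𝕄} (h : EqTpOver L C a b)
    (h' : EqTpOver L C b d) : EqTpOver L C a d :=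
  fun n φ c hc => (h n φ c hc).trans (h' n φ c hc)

theorem eqTpOver_equiv_comp {C : Set 𝕄} {β : Type v} (σ : 𝕄 ≃[L] 𝕄) (hσ : ∀ x ∈ C, σ x = x)
    (a : β → 𝕄) : EqTpOver L C (σ ∘ a) a := by
  intro n φ c hc
  rw [← StrongHomClass.realize_formula σ φ (v := Sum.elim a c), Sum.comp_elim]
  have : σ ∘ c = c := funext fun i => hσ _ (hc i)
  rw [this]

theorem EqTpOver.comp {C : Set 𝕄} {β : Type v} {δ : Type w} {a b : β → 𝕄}
    (h : EqTpOver L C a b) (f : δ → β) : EqTpOver L C (a ∘ f) (b ∘ f) :=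
  eqTpOver_iff.2 fun _ hS => eqTpOver_iff.1 h _ (hS.preimage_comp f)

theorem FinSatIn.mono {Ms C D : Set 𝕄} {β : Type v} {a : β → 𝕄} (h : FinSatIn L Ms a D)
    (hCD : C ⊆ D) : FinSatIn L Ms a C :=
  fun n φ c hc => h n φ c fun i => hCD (hc i)

theorem FinSatIn.comp {Ms C : Set 𝕄} {β : Type v} {δ : Type w} {a : β → 𝕄}
    (h : FinSatIn L Ms a C) (f : δ → β) : FinSatIn L Ms (a ∘ f) C := by
  refine finSatIn_iff.2 fun S hS ha => ?_
  obtain ⟨m, hm, hmS⟩ := finSatIn_iff.1 h _ (hS.preimage_comp f) ha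
  exact ⟨m ∘ f, fun i => hm _, hmS⟩

/-- Left transitivity of finite satisfiability. -/
theorem FinSatIn.sumElim {Ms C : Set 𝕄} {β : Type v} {γ : Type w} {a : β → 𝕄} {b : γ → 𝕄}
    (hMs : Ms ⊆ C) (ha : FinSatIn L Ms a (C ∪ Set.range b)) (hb : FinSatIn L Ms b C) :
    FinSatIn L Ms (Sum.elim a b) C := by
  refine finSatIn_iff.2 fun S hS hab => ?_
  obtain ⟨m, hm, hmS⟩ := finSatIn_iff.1 ha _ ((hS.mono Set.subset_union_left).section_left b
    fun i => Or.inr ⟨i, rfl⟩) hab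
  obtain ⟨m', hm', hmS'⟩ := finSatIn_iff.1 hb _ (hS.section_right m fun i => hMs (hm i)) hmS
  exact ⟨Sum.elim m m', fun i => by rcases i with i | i <;> simp [hm, hm'], hmS'⟩

/-- A type finitely satisfiable in `Ms` is `Ms`-invariant. -/
theorem FinSatIn.eqTpOver_sumElim {Ms C : Set 𝕄} {β : Type v} {γ : Type w} {a : β → 𝕄}
    {b b' : γ → 𝕄} (hMs : Ms ⊆ C) (ha : FinSatIn L Ms a C) (hb : ∀ i, b i ∈ C)
    (hb' : ∀ i, b' i ∈ C) (hbb' : EqTpOver L Ms b b') :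
    EqTpOver L Ms (Sum.elim a b) (Sum.elim a b') := by
  refine eqTpOver_iff.2 fun S hS hab => ?_
  by_contra hab'
  obtain ⟨m, hm, h1, h2⟩ := finSatIn_iff.1 ha _
    (((hS.mono hMs).section_left b hb).diff ((hS.mono hMs).section_left b' hb')) ⟨hab, hab'⟩
  exact h2 (eqTpOver_iff.1 hbb' _ (hS.section_right m hm) h1)

/-! ### Consequences of saturation and homogeneity -/

theorem IsMonster.exists_mem_of_finite_inter {κ : Cardinal.{u}} (h : IsMonster L 𝕄 κ)
    {γ : Type} [Finite γ] {D : Set 𝕄} (hD : Cardinal.mk D < κ) (Γ : Set (Set (γ → 𝕄)))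
    (hΓ : ∀ S ∈ Γ, DefOver L D S)
    (hfin : ∀ t : Finset (Set (γ → 𝕄)), ↑t ⊆ Γ → ∃ a, ∀ S ∈ t, a ∈ S) :
    ∃ a, ∀ S ∈ Γ, a ∈ S := by
  classical
  let sol : FmlP L 𝕄 (ULift.{u} γ) → Set (γ → 𝕄) := fun p =>
    {a | p.2.1.Realize (Sum.elim (a ∘ ULift.down) p.2.2)}
  obtain ⟨a, ha⟩ := h.2.1 (ULift.{u} γ) D ((Cardinal.lt_aleph0_of_finite _).trans h.1) hD
    {p | (∀ i, p.2.2 i ∈ D) ∧ sol p ∈ Γ} (fun p hp => hp.1) (fun t ht => by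
      obtain ⟨a, ha⟩ := hfin (t.image sol) (by
        intro S hS
        obtain ⟨p, hp, rfl⟩ := Finset.mem_image.1 (Finset.mem_coe.1 hS)
        exact (ht hp).2)
      exact ⟨a ∘ ULift.down, fun p hp => ha _ (Finset.mem_image_of_mem sol hp)⟩)
  refine ⟨a ∘ ULift.up, fun S hS => ?_⟩
  obtain ⟨n, φ, c, hc, hφ⟩ := ((hΓ S hS).preimage_comp (β := ULift.{u} γ) ULift.up).exists_formula
  have hsol : sol ⟨n, φ, c⟩ = S := by
    ext b
    have : b ∘ ULift.down ∈ {u : ULift.{u} γ → 𝕄 | u ∘ ULift.up ∈ S} ↔ b ∈ S := Iff.rfl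
    rw [← this, hφ]
    rfl
  have := ha ⟨n, φ, c⟩ ⟨hc, by rw [hsol]; exact hS⟩
  have hmem : a ∈ {u : ULift.{u} γ → 𝕄 | u ∘ ULift.up ∈ S} := by rw [hφ]; exact this
  exact hmem

/-- Right extension for finite satisfiability. -/
theorem IsMonster.exists_finSatIn_extension {κ : Cardinal.{u}} (h : IsMonster L 𝕄 κ)
    {γ : Type} [Finite γ] {Ms C D : Set 𝕄} (hD : Cardinal.mk D < κ) (hCD : C ⊆ D)
    {a : γ → 𝕄} (ha : FinSatIn L Ms a C) :
    ∃ a' : γ → 𝕄, EqTpOver L C a a' ∧ FinSatIn L Ms a' D := by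
  obtain ⟨a', ha'⟩ := h.exists_mem_of_finite_inter hD
    {S | (DefOver L C S ∧ a ∈ S) ∨ (DefOver L D S ∧ ∀ m : γ → 𝕄, (∀ i, m i ∈ Ms) → m ∈ S)}
    (by rintro S (hS | hS); exacts [hS.1.mono hCD, hS.1]) (by
      classical
      intro t ht
      obtain ⟨m, hm, hmS⟩ := finSatIn_iff.1 ha (⋂ S ∈ t.filter fun S => DefOver L C S ∧ a ∈ S, S)
        (.biInter _ fun S hS => (Finset.mem_filter.1 hS).2.1)
        (by simp only [Set.mem_iInter]; exact fun S hS => (Finset.mem_filter.1 hS).2.2)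
      simp only [Set.mem_iInter] at hmS
      refine ⟨m, fun S hS => ?_⟩
      rcases ht hS with h1 | h1
      · exact hmS S (Finset.mem_filter.2 ⟨hS, h1⟩)
      · exact h1.2 m hm)
  refine ⟨a', eqTpOver_iff.2 fun S hS haS => ha' S (Or.inl ⟨hS, haS⟩),
    finSatIn_iff.2 fun S hS haS => ?_⟩
  by_contra hcon
  push Not at hcon
  exact ha' Sᶜ (Or.inr ⟨hS.compl, hcon⟩) haS

theorem IsMonster.exists_equiv_of_eqTpOver {κ : Cardinal.{u}} (h : IsMonster L 𝕄 κ)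
    {γ : Type} [Finite γ] {C : Set 𝕄} (hC : Cardinal.mk C < κ) {a b : γ → 𝕄}
    (hab : EqTpOver L C a b) :
    ∃ σ : 𝕄 ≃[L] 𝕄, (∀ x ∈ C, σ x = x) ∧ σ ∘ a = b := by
  obtain ⟨σ, hσ⟩ := h.2.2 (ULift.{u} γ ⊕ C)
    (by
      rw [Cardinal.mk_sum, Cardinal.lift_id, Cardinal.lift_id]
      exact Cardinal.add_lt_of_lt h.1.le ((Cardinal.lt_aleph0_of_finite _).trans h.1) hC)
    (Sum.elim (a ∘ ULift.down) (fun x : C => (x : 𝕄)))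
    (Sum.elim (b ∘ ULift.down) (fun x : C => (x : 𝕄))) (by
      refine eqTpOver_iff.2 fun S hS haS => ?_
      exact eqTpOver_iff.1 hab _ ((((hS.mono (Set.empty_subset C)).section_left
        (fun x : C => (x : 𝕄)) fun x => x.2)).preimage_comp ULift.down) haS)
  exact ⟨σ, fun x hx => hσ (Sum.inr ⟨x, hx⟩), funext fun i => hσ (Sum.inl ⟨i⟩)⟩

/-! ### Coheir Morley sequences -/

theorem RealizesType.exists_mem_carrier {C : Set 𝕄} {β : Type v} {q : GlobalType L 𝕄 β}
    {a : β → 𝕄} (h : RealizesType q a C) {S : Set (β → 𝕄)} (hS : DefOver L C S) (ha : a ∈ S) :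
    ∃ p ∈ q.carrier, S = {x | p.2.1.Realize (Sum.elim x p.2.2)} := by
  obtain ⟨n, φ, c, hc, rfl⟩ := hS.exists_formula
  refine ⟨⟨n, φ, c⟩, (q.complete n φ c).resolve_right fun hn => ?_, rfl⟩
  exact (Formula.realize_not.1 (h n _ c hc hn)) ha

theorem RealizesType.finSatIn {Ms C : Set 𝕄} {β : Type v} {q : GlobalType L 𝕄 β}
    {a : β → 𝕄} (hq : q.FinSatInM Ms) (h : RealizesType q a C) : FinSatIn L Ms a C := by
  refine finSatIn_iff.2 fun S hS ha => ?_
  obtain ⟨p, hp, rfl⟩ := h.exists_mem_carrier hS ha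
  obtain ⟨m, hm, hmp⟩ := hq {p} (by simpa using hp)
  exact ⟨m, hm, hmp p (by simp)⟩

theorem RealizesType.eqTpOver_sumElim {Ms C C' : Set 𝕄} {β : Type v} {γ : Type w}
    {q : GlobalType L 𝕄 β} {a a' : β → 𝕄} {b b' : γ → 𝕄} (hq : q.FinSatInM Ms)
    (h : RealizesType q a C) (h' : RealizesType q a' C') (hC : Ms ⊆ C) (hC' : Ms ⊆ C')
    (hb : ∀ i, b i ∈ C) (hb' : ∀ i, b' i ∈ C') (hbb' : EqTpOver L Ms b b') :
    EqTpOver L Ms (Sum.elim a b) (Sum.elim a' b') := by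
  classical
  refine eqTpOver_iff.2 fun S hS hab => ?_
  by_contra hab'
  obtain ⟨p, hp, hpS⟩ := h.exists_mem_carrier ((hS.mono hC).section_left b hb) hab
  obtain ⟨p', hp', hpS'⟩ :=
    h'.exists_mem_carrier ((hS.mono hC').section_left b' hb').compl hab'
  obtain ⟨m, hm, hmp⟩ := hq {p, p'} (by
    intro r hr
    rcases Finset.mem_insert.1 (Finset.mem_coe.1 hr) with rfl | hr
    · exact hp
    · rwa [Finset.mem_singleton.1 hr])
  have h1 : m ∈ {u : β → 𝕄 | Sum.elim u b ∈ S} := by rw [hpS]; exact hmp p (by simp)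
  have h2 : m ∈ {u : β → 𝕄 | Sum.elim u b' ∈ S}ᶜ := by rw [hpS']; exact hmp p' (by simp)
  exact h2 (eqTpOver_iff.1 hbb' _ (hS.section_right m hm) h1)

/-- The tuple listing `B l, …, B (l + n - 1)`. -/
def segment {δ : Type v} (B : ℕ → δ → 𝕄) (l n : ℕ) : Fin n × δ → 𝕄 :=
  fun p => B (l + p.1) p.2

/-- Reindexing that splits off the last entry of a segment. -/
def splitLast (n : ℕ) (δ : Type v) (p : Fin (n + 1) × δ) : δ ⊕ (Fin n × δ) :=
  if h : p.1.1 < n then Sum.inr (⟨p.1.1, h⟩, p.2) else Sum.inl p.2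

theorem segment_succ {δ : Type v} (B : ℕ → δ → 𝕄) (l n : ℕ) :
    segment B l (n + 1) = Sum.elim (B (l + n)) (segment B l n) ∘ splitLast n δ := by
  funext ⟨⟨j, hj⟩, d⟩
  by_cases h : j < n
  · simp [segment, splitLast, h]
  · obtain rfl : j = n := by omega
    simp [segment, splitLast]

theorem segment_mem {δ : Type v} (B : ℕ → δ → 𝕄) (Ms : Set 𝕄) (l n : ℕ) (p : Fin n × δ) :
    segment B l n p ∈ Ms ∪ ⋃ (j : ℕ) (_ : j < l + n), Set.range (B j) := by
  refine Or.inr ?_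
  simp only [Set.mem_iUnion]
  exact ⟨l + p.1, by omega, p.2, rfl⟩

theorem MorleyIn.eqTpOver_segment {δ : Type v} {Ms : Set 𝕄} {q : GlobalType L 𝕄 δ}
    {B : ℕ → δ → 𝕄} (h : MorleyIn q Ms B) (l l' n : ℕ) :
    EqTpOver L Ms (segment B l n) (segment B l' n) := by
  induction n with
  | zero =>
    have : segment B l 0 = segment B l' 0 := funext fun p => p.1.elim0
    rw [this]
    exact fun _ _ _ _ => Iff.rfl
  | succ n ih =>
    rw [segment_succ, segment_succ]
    exact ((h.2 (l + n)).eqTpOver_sumElim h.1 (h.2 (l' + n)) Set.subset_union_left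
      Set.subset_union_left (segment_mem B Ms l n) (segment_mem B Ms l' n) ih).comp _

theorem MorleyIn.finSatIn_segment {δ : Type v} {Ms : Set 𝕄} {q : GlobalType L 𝕄 δ}
    {B : ℕ → δ → 𝕄} (h : MorleyIn q Ms B) (n : ℕ) :
    FinSatIn L Ms (segment B 1 n) (Ms ∪ Set.range (B 0)) := by
  induction n with
  | zero => exact finSatIn_iff.2 fun S _ ha => ⟨_, fun p => p.1.elim0, ha⟩
  | succ n ih =>
    rw [segment_succ]
    refine (FinSatIn.sumElim Set.subset_union_left ?_ ih).comp _
    refine ((h.2 (1 + n)).finSatIn h.1).mono ?_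
    rintro x ((hx | hx) | ⟨p, rfl⟩)
    · exact Or.inl hx
    · refine Or.inr ?_
      simp only [Set.mem_iUnion]
      exact ⟨0, by omega, hx⟩
    · exact segment_mem B Ms 1 n p

/-! ### The action of automorphisms on definable sets -/

/-- The image of a set of tuples under an automorphism. -/
def act {β : Type v} (σ : 𝕄 ≃[L] 𝕄) (S : Set (β → 𝕄)) : Set (β → 𝕄) :=
  (fun a => σ ∘ a) '' S

theorem mem_act {β : Type v} {σ : 𝕄 ≃[L] 𝕄} {S : Set (β → 𝕄)} {x : β → 𝕄} :
    x ∈ act σ S ↔ σ.symm ∘ x ∈ S := by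
  constructor
  · rintro ⟨a, ha, rfl⟩
    have : σ.symm ∘ σ ∘ a = a := funext fun i => σ.symm_apply_apply (a i)
    simpa only [this] using ha
  · intro h
    exact ⟨_, h, funext fun i => σ.apply_symm_apply (x i)⟩

theorem act_inter {β : Type v} (σ : 𝕄 ≃[L] 𝕄) (S T : Set (β → 𝕄)) :
    act σ (S ∩ T) = act σ S ∩ act σ T := by
  ext x; simp only [mem_act, Set.mem_inter_iff]

theorem act_diff {β : Type v} (σ : 𝕄 ≃[L] 𝕄) (S T : Set (β → 𝕄)) :
    act σ (S \ T) = act σ S \ act σ T := by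
  ext x; simp only [mem_act, Set.mem_sdiff]

theorem act_comp {β : Type v} (σ τ : 𝕄 ≃[L] 𝕄) (S : Set (β → 𝕄)) :
    act (σ.comp τ) S = act σ (act τ S) := by
  ext x
  rw [mem_act, mem_act, mem_act]
  have : (σ.comp τ).symm ∘ x = τ.symm ∘ σ.symm ∘ x := by
    funext i
    apply (σ.comp τ).injective
    simp
  rw [this]

theorem act_setOf_realize {β : Type v} {γ : Type w} (σ : 𝕄 ≃[L] 𝕄) (φ : L.Formula (β ⊕ γ))
    (c : γ → 𝕄) :
    act σ {a : β → 𝕄 | φ.Realize (Sum.elim a c)} =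
      {a : β → 𝕄 | φ.Realize (Sum.elim a (σ ∘ c))} := by
  ext x
  rw [mem_act, Set.mem_ofPred_eq, Set.mem_ofPred_eq, ← StrongHomClass.realize_formula σ φ,
    Sum.comp_elim]
  have : σ ∘ σ.symm ∘ x = x := funext fun i => σ.apply_symm_apply (x i)
  rw [this]

theorem DefOver.act_eq {C : Set 𝕄} {β : Type v} {S : Set (β → 𝕄)} (h : DefOver L C S)
    {σ : 𝕄 ≃[L] 𝕄} (hσ : ∀ x ∈ C, σ x = x) : act σ S = S := by
  obtain ⟨φ, rfl⟩ := h
  rw [act_setOf_realize]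
  have : σ ∘ (fun x : C => (x : 𝕄)) = fun x : C => (x : 𝕄) := funext fun x => hσ x x.2
  rw [this]

theorem DefOver.act_univ {β : Type v} {S : Set (β → 𝕄)} (h : DefOver L Set.univ S)
    (σ : 𝕄 ≃[L] 𝕄) : DefOver L Set.univ (act σ S) := by
  obtain ⟨n, φ, c, hc, rfl⟩ := h.exists_formula
  rw [act_setOf_realize]
  exact .of_formula _ _ fun _ => Set.mem_univ _

theorem symm_fixes {C : Set 𝕄} {σ : 𝕄 ≃[L] 𝕄} (hσ : ∀ x ∈ C, σ x = x) :
    ∀ x ∈ C, σ.symm x = x := fun x hx => by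
  conv_lhs => rw [← hσ x hx]
  exact σ.symm_apply_apply x

/-- Finite (nonempty) intersections of `Aut(𝕄 / Ms)`-conjugates of `A`. -/
inductive ConjInter (Ms : Set 𝕄) {β : Type v} (A : Set (β → 𝕄)) : Set (β → 𝕄) → Prop
  | conj (σ : 𝕄 ≃[L] 𝕄) (hσ : ∀ x ∈ Ms, σ x = x) : ConjInter Ms A (act σ A)
  | inter {E E' : Set (β → 𝕄)} : ConjInter Ms A E → ConjInter Ms A E' →
      ConjInter Ms A (E ∩ E')

theorem act_refl {β : Type v} (S : Set (β → 𝕄)) : act (Language.Equiv.refl L 𝕄) S = S := by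
  ext x; rw [mem_act]; rfl

theorem ConjInter.of_act {Ms : Set 𝕄} {β : Type v} {A E : Set (β → 𝕄)} {σ : 𝕄 ≃[L] 𝕄}
    (hσ : ∀ x ∈ Ms, σ x = x) (h : ConjInter (L := L) Ms A E) :
    ConjInter (L := L) Ms A (act σ E) := by
  induction h with
  | conj τ hτ =>
    rw [← act_comp]
    exact .conj _ fun x hx => by simp [hτ x hx, hσ x hx]
  | inter _ _ ih ih' => rw [act_inter]; exact .inter ih ih'

theorem ConjInter.trans {Ms : Set 𝕄} {β : Type v} {A E F : Set (β → 𝕄)}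
    (h : ConjInter (L := L) Ms E F) (hE : ConjInter (L := L) Ms A E) :
    ConjInter (L := L) Ms A F := by
  induction h with
  | conj τ hτ => exact hE.of_act hτ
  | inter _ _ ih ih' => exact .inter ih ih'

theorem ConjInter.self {Ms : Set 𝕄} {β : Type v} {A : Set (β → 𝕄)} :
    ConjInter (L := L) Ms A A := by
  have := ConjInter.conj (Ms := Ms) (A := A) (Language.Equiv.refl L 𝕄) fun _ _ => rfl
  rwa [act_refl] at this

theorem ConjInter.defOver {Ms : Set 𝕄} {β : Type v} {A E : Set (β → 𝕄)}
    (h : ConjInter (L := L) Ms A E) (hA : DefOver L Set.univ A) : DefOver L Set.univ E := by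
  induction h with
  | conj τ _ => exact hA.act_univ τ
  | inter _ _ ih ih' => exact ih.inter ih'

theorem ConjInter.exists_tuples {Ms : Set 𝕄} {β : Type v} {s : ℕ} {φ : L.Formula (β ⊕ Fin s)}
    {e : Fin s → 𝕄} {E : Set (β → 𝕄)}
    (h : ConjInter (L := L) Ms {x : β → 𝕄 | φ.Realize (Sum.elim x e)} E) :
    ∃ (mm : ℕ) (e' : Fin mm → Fin s → 𝕄), 0 < mm ∧ (∀ j, EqTpOver L Ms (e' j) e) ∧
      E = ⋂ j, {x : β → 𝕄 | φ.Realize (Sum.elim x (e' j))} := by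
  induction h with
  | conj σ hσ =>
    refine ⟨1, fun _ => σ ∘ e, one_pos, fun _ => eqTpOver_equiv_comp σ hσ e, ?_⟩
    rw [act_setOf_realize, Set.iInter_const]
  | inter _ _ ih ih' =>
    obtain ⟨m, f, hm, hf, rfl⟩ := ih
    obtain ⟨m', f', _, hf', rfl⟩ := ih'
    refine ⟨m + m', Fin.append f f', by omega, fun j => ?_, ?_⟩
    · refine Fin.addCases (fun i => ?_) (fun i => ?_) j
      · rw [Fin.append_left]; exact hf i
      · rw [Fin.append_right]; exact hf' i
    · ext x
      simp only [Set.mem_inter_iff, Set.mem_iInter, Set.mem_ofPred_eq]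
      constructor
      · rintro ⟨h1, h2⟩ j
        refine Fin.addCases (fun i => ?_) (fun i => ?_) j
        · rw [Fin.append_left]; exact h1 i
        · rw [Fin.append_right]; exact h2 i
      · intro h
        refine ⟨fun i => ?_, fun i => ?_⟩
        · simpa only [Fin.append_left] using h (Fin.castAdd m' i)
        · simpa only [Fin.append_right] using h (Fin.natAdd m i)

/-! ### The broom lemma -/

theorem InvIdeal.mem_of_subset {Ms : Set 𝕄} {α : Type v} (I : InvIdeal L 𝕄 Ms α)
    {C : Set 𝕄} {S T : Set (α → 𝕄)} (hS : I.mem S) (hT : DefOver L C T) (hTS : T ⊆ S) :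
    I.mem T := by
  obtain ⟨n, φ, c, -, h⟩ := hT.exists_formula
  exact I.subset_mem S T hS ⟨n, φ, c, h⟩ hTS

theorem InvIdeal.mem_act {Ms : Set 𝕄} {α : Type v} (I : InvIdeal L 𝕄 Ms α)
    {σ : 𝕄 ≃[L] 𝕄} (hσ : ∀ x ∈ Ms, σ x = x) {S : Set (α → 𝕄)} (hS : I.mem S) :
    I.mem (act σ S) :=
  I.invariant σ hσ S hS

/-- A sequence witnessing `𝓘`-Kim-dividing can be chosen so that its tail is finitely
satisfiable over any given small set. -/
theorem IKimDivides.exists_sequence {κ : Cardinal.{u}} (h : IsMonster L 𝕄 κ) {Ms D : Set 𝕄}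
    (hD : Cardinal.mk D < κ) (hMs : Ms ⊆ D) {α : Type v} {I : InvIdeal L 𝕄 Ms α} {n : ℕ}
    {φ : L.Formula (α ⊕ Fin n)} {b : Fin n → 𝕄} (hb : Set.range b ⊆ D)
    (hdiv : IKimDivides I φ b) :
    ∃ (B : ℕ → Fin n → 𝕄) (k : ℕ), B 0 = b ∧
      I.mem {x | ∀ j ∈ Finset.range (k + 1), φ.Realize (Sum.elim x (B j))} ∧
      EqTpOver L Ms (segment B 1 k) (segment B 0 k) ∧ FinSatIn L Ms (segment B 1 k) D := by
  obtain ⟨B, k, ⟨q, hq⟩, rfl, hk, hmem⟩ := hdiv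
  obtain ⟨k, rfl⟩ : ∃ k', k = k' + 1 := ⟨k - 1, by omega⟩
  have hC : Ms ∪ Set.range (B 0) ⊆ D := Set.union_subset hMs hb
  obtain ⟨u, hu, huD⟩ := h.exists_finSatIn_extension hD hC (hq.finSatIn_segment k)
  obtain ⟨σ, hσ, rfl⟩ := h.exists_equiv_of_eqTpOver
    ((Cardinal.mk_le_mk_of_subset hC).trans_lt hD) hu
  have hσM : ∀ x ∈ Ms, σ x = x := fun x hx => hσ x (Or.inl hx)
  have hseg : ∀ l, segment (fun j => σ ∘ B j) l k = σ ∘ segment B l k := fun l => rfl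
  refine ⟨fun j => σ ∘ B j, k, funext fun i => hσ _ (Or.inr ⟨i, rfl⟩), ?_, ?_, huD⟩
  · convert I.mem_act hσM (hmem (Finset.range (k + 1)) (Finset.card_range _)) using 1
    ext x
    simp only [NSOP2Paper.mem_act, Set.mem_ofPred_eq]
    refine forall₂_congr fun j _ => ?_
    have := act_setOf_realize σ φ (B j)
    exact (Set.ext_iff.1 this x).symm.trans NSOP2Paper.mem_act
  · rw [hseg, hseg]
    exact ((eqTpOver_equiv_comp σ hσM _).trans (hq.eqTpOver_segment 1 0 k)).trans
      (eqTpOver_equiv_comp σ hσM _).symm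

/-- One step of the broom lemma: a single `𝓘`-Kim-dividing formula is removed, given that the
remaining definable set `F` can be removed. -/
theorem IKimDivides.broom_step {κ : Cardinal.{u}} (h : IsMonster L 𝕄 κ) {Ms D D' : Set 𝕄}
    (hD' : Cardinal.mk D' < κ) (hMs : Ms ⊆ D) (hDD' : D ⊆ D') {α : Type v}
    {I : InvIdeal L 𝕄 Ms α} {n : ℕ} {φ : L.Formula (α ⊕ Fin n)} {b : Fin n → 𝕄}
    (hb : Set.range b ⊆ D') (hdiv : IKimDivides I φ b) {F : Set (α → 𝕄)} (hF : DefOver L D F)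
    (ih : ∀ (γ : Type) [Finite γ] (c : γ → 𝕄) (X A : Set (α → 𝕄)),
      DefOver L (Ms ∪ Set.range c) X → DefOver L Set.univ A → FinSatIn L Ms c D →
      I.mem (A \ (X ∪ F)) → ∃ E, ConjInter (L := L) Ms A E ∧ I.mem (E \ X))
    {γ : Type} [Finite γ] {c : γ → 𝕄} {X A : Set (α → 𝕄)} (hX : DefOver L (Ms ∪ Set.range c) X)
    (hA : DefOver L Set.univ A) (hc : FinSatIn L Ms c D')
    (hmem : I.mem (A \ (X ∪ ({x | φ.Realize (Sum.elim x b)} ∪ F)))) :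
    ∃ E, ConjInter (L := L) Ms A E ∧ I.mem (E \ X) := by
  have hMs' := hMs.trans hDD'
  obtain ⟨B, k, rfl, hB, hBeq, hBfin⟩ := hdiv.exists_sequence h hD' hMs' hb
  have hD'' : Cardinal.mk ↥(D' ∪ Set.range (segment B 1 k)) < κ :=
    (Cardinal.mk_union_le _ _).trans_lt (Cardinal.add_lt_of_lt h.1.le hD'
      ((Cardinal.lt_aleph0_of_finite _).trans h.1))
  -- Move `c` over `D'` so that it becomes independent from the sequence.
  obtain ⟨c', hcc', hc'⟩ := h.exists_finSatIn_extension hD'' Set.subset_union_left hc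
  obtain ⟨τ, hτ, rfl⟩ := h.exists_equiv_of_eqTpOver hD' hcc'
  have hτM : ∀ x ∈ Ms, τ x = x := fun x hx => hτ x (hMs' hx)
  suffices hs : ∃ E, ConjInter (L := L) Ms (act τ A) E ∧ I.mem (E \ act τ X) by
    obtain ⟨E, hE, hEX⟩ := hs
    have hτs := symm_fixes hτM
    refine ⟨act τ.symm E, (hE.trans (.conj τ hτM)).of_act hτs, ?_⟩
    have := I.mem_act hτs hEX
    rw [act_diff, ← act_comp] at this
    simpa [act_refl] using this
  have hX' : DefOver L (Ms ∪ Set.range (τ ∘ c)) (act τ X) := by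
    obtain ⟨m, ψ, d, hd, rfl⟩ := hX.exists_formula
    rw [act_setOf_realize]
    refine .of_formula _ _ fun i => ?_
    rcases hd i with hi | ⟨j, hj⟩
    · exact Or.inl (by simpa [hτM _ hi] using hi)
    · exact Or.inr ⟨j, by simp [hj]⟩
  have hb0 : DefOver L D' {x : α → 𝕄 | φ.Realize (Sum.elim x (B 0))} :=
    .of_formula _ _ fun i => hb ⟨i, rfl⟩
  have hmem' : I.mem (act τ A \ (act τ X ∪ ({x | φ.Realize (Sum.elim x (B 0))} ∪ F))) := by
    have := I.mem_act hτM hmem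
    rw [act_diff] at this
    convert this using 2
    have h2 := (hb0.union (hF.mono hDD')).act_eq hτ
    ext x
    have h3 := Set.ext_iff.1 h2 x
    rw [mem_act] at h3
    simp only [mem_act, Set.mem_union] at h3 ⊢
    tauto
  have hA' := hA.act_univ τ
  generalize act τ A = A at hmem' hA' ⊢
  generalize act τ X = X at hmem' hX' ⊢
  generalize τ ∘ c = c at hc' hX' ⊢
  clear hmem hA hcc' hX hc
  -- An automorphism over `Ms c` shifting the sequence.
  have hseg : ∀ i, segment B 0 k i ∈ D' ∪ Set.range (segment B 1 k) := by
    rintro ⟨⟨j, hj⟩, d⟩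
    rcases j with _ | j
    · exact Or.inl (hb ⟨d, rfl⟩)
    · refine Or.inr ⟨(⟨j, by omega⟩, d), ?_⟩
      simp [segment, add_comm]
  obtain ⟨ρ, hρ, hρs⟩ := h.exists_equiv_of_eqTpOver
    ((Cardinal.mk_le_mk_of_subset hMs').trans_lt hD')
    (hc'.eqTpOver_sumElim (hMs'.trans Set.subset_union_left)
      (fun i => Or.inr ⟨i, rfl⟩) hseg hBeq)
  have hρX : act ρ X = X := hX'.act_eq fun x hx => by
    rcases hx with hx | ⟨i, rfl⟩
    · exact hρ x hx
    · exact congrFun hρs (Sum.inl i)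
  have hρB : ∀ j < k, ρ ∘ B (j + 1) = B j := fun j hj => funext fun d => by
    simpa [segment, add_comm] using congrFun hρs (Sum.inr (⟨j, hj⟩, d))
  let G : ℕ → Set (α → 𝕄) := fun j => {x | φ.Realize (Sum.elim x (B j))}
  have hG : ∀ j, DefOver L (Set.range (B j)) (G j) := fun j => .of_formula _ _ fun i => ⟨i, rfl⟩
  have hρG : ∀ j < k, act ρ (G (j + 1)) = G j := fun j hj => by
    rw [act_setOf_realize, hρB j hj]
  -- Remove the members of the sequence one at a time.
  have key : ∀ r ≤ k + 1, ∃ E, ConjInter (L := L) Ms A E ∧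
      I.mem ((E ∩ ⋂ j ∈ Finset.range r, G j) \ X) := by
    intro r hr
    induction hr using Nat.decreasingInduction with
    | self =>
      refine ⟨A, .self, I.mem_of_subset hB (((hA'.inter (DefOver.biInter _ fun j _ =>
        (hG j).mono (Set.subset_univ _)))).diff (hX'.mono (Set.subset_univ _))) ?_⟩
      rintro x ⟨⟨-, hx⟩, -⟩
      exact fun j hj => Set.mem_iInter₂.1 hx j hj
    | of_succ r hr ihr =>
      obtain ⟨E, hE, hEmem⟩ := ihr
      set W : Set (α → 𝕄) := ⋂ j ∈ Finset.range r, G (j + 1) with hW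
      have hWdef : DefOver L (Ms ∪ Set.range (Sum.elim c (segment B 1 k))) W := by
        refine .biInter _ fun j hj => (hG (j + 1)).mono ?_
        rintro _ ⟨d, rfl⟩
        refine Or.inr ⟨Sum.inr (⟨j, by have := Finset.mem_range.1 hj; omega⟩, d), ?_⟩
        simp [segment, add_comm]
      have hfin : FinSatIn L Ms (Sum.elim c (segment B 1 k)) D' :=
        hc'.sumElim hMs' hBfin
      obtain ⟨E', hE', hE'mem⟩ := ih _ (Sum.elim c (segment B 1 k)) (X ∪ Wᶜ) (E ∩ A)
        ((hX'.mono (Set.union_subset_union_right _ (by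
          rintro _ ⟨i, rfl⟩; exact ⟨Sum.inl i, rfl⟩))).union hWdef.compl)
        ((hE.defOver hA').inter hA') (hfin.mono hDD') (by
          refine I.mem_of_subset (I.union_mem _ _ hEmem hmem')
            (((hE.defOver hA').inter hA').diff (((hX'.mono (Set.subset_univ _)).union
              (hWdef.compl.mono (Set.subset_univ _))).union (hF.mono (Set.subset_univ _)))) ?_
          rintro x ⟨⟨hxE, hxA⟩, hx⟩
          simp only [Set.mem_union, not_or, Set.mem_compl_iff, not_not] at hx
          by_cases h0 : x ∈ G 0
          · refine Or.inl ⟨⟨hxE, Set.mem_iInter₂.2 fun j hj => ?_⟩, hx.1.1⟩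
            rcases j with _ | j
            · exact h0
            · exact Set.mem_iInter₂.1 hx.1.2 j
                (Finset.mem_range.2 (by have := Finset.mem_range.1 hj; omega))
          · refine Or.inr ⟨hxA, ?_⟩
            rintro (hx' | hx' | hx')
            exacts [hx.1.1 hx', h0 hx', hx.2 hx'])
      refine ⟨act ρ E', (hE'.trans (hE.inter .self)).of_act hρ, ?_⟩
      convert I.mem_act hρ hE'mem using 1
      rw [act_diff]
      ext x
      have hX1 : ρ.symm ∘ x ∈ X ↔ x ∈ X := by rw [← mem_act, hρX]
      have hW1 : ρ.symm ∘ x ∈ W ↔ x ∈ ⋂ j ∈ Finset.range r, G j := by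
        simp only [hW, Set.mem_iInter]
        refine forall₂_congr fun j hj => ?_
        rw [← mem_act, hρG j (by have := Finset.mem_range.1 hj; omega)]
      simp only [Set.mem_sdiff, Set.mem_inter_iff, mem_act, Set.mem_union, Set.mem_compl_iff,
        hX1, hW1]
      tauto
  obtain ⟨E, hE, hEX⟩ := key 0 (Nat.zero_le _)
  exact ⟨E, hE, by simpa using hEX⟩

theorem broom_of_finset {κ : Cardinal.{u}} (h : IsMonster L 𝕄 κ) {Ms : Set 𝕄}
    (hMs : Cardinal.mk Ms < κ) {α : Type v} (I : InvIdeal L 𝕄 Ms α) {ι : Type}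
    (mv : ι → ℕ) (Φ : ∀ i, L.Formula (α ⊕ Fin (mv i))) (aa : ∀ i, Fin (mv i) → 𝕄)
    (hdiv : ∀ i, IKimDivides I (Φ i) (aa i)) (s : Finset ι)
    (γ : Type) [Finite γ] (c : γ → 𝕄) (X A : Set (α → 𝕄))
    (hX : DefOver L (Ms ∪ Set.range c) X) (hA : DefOver L Set.univ A)
    (hc : FinSatIn L Ms c (Ms ∪ ⋃ i ∈ s, Set.range (aa i)))
    (hmem : I.mem (A \ (X ∪ ⋃ i ∈ s, {x | (Φ i).Realize (Sum.elim x (aa i))}))) :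
    ∃ E, ConjInter (L := L) Ms A E ∧ I.mem (E \ X) := by
  classical
  induction s using Finset.induction_on generalizing γ c X A with
  | empty => exact ⟨A, .self, by simpa using hmem⟩
  | insert i s _ ih =>
    rw [Finset.set_biUnion_insert] at hmem hc
    have hfin : ((⋃ j ∈ s, Set.range (aa j)) : Set 𝕄).Finite :=
      s.finite_toSet.biUnion fun j _ => Set.finite_range (aa j)
    have hfin' := ((Set.finite_range (aa i)).union hfin).lt_aleph0
    refine (hdiv i).broom_step h (D := Ms ∪ ⋃ j ∈ s, Set.range (aa j))
      ((Cardinal.mk_union_le _ _).trans_lt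
        (Cardinal.add_lt_of_lt h.1.le hMs (hfin'.trans h.1)))
      Set.subset_union_left (Set.union_subset_union_right _ Set.subset_union_right)
      (Set.subset_union_left.trans Set.subset_union_right) ?_
      (fun γ _ c X A => ih γ c X A) hX hA hc hmem
    have : (⋃ j ∈ s, {x : α → 𝕄 | (Φ j).Realize (Sum.elim x (aa j))}) =
        (⋂ j ∈ s, {x : α → 𝕄 | (Φ j).Realize (Sum.elim x (aa j))}ᶜ)ᶜ := by
      simp
    rw [this]
    refine (DefOver.biInter _ fun j hj => (DefOver.of_formula _ _ fun d => ?_).compl).compl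
    exact Or.inr (Set.mem_biUnion hj ⟨d, rfl⟩)

theorem exists_conjugates_of_broom {κ : Cardinal.{u}} (h : IsMonster L 𝕄 κ) {Ms : Set 𝕄}
    (hMs : Cardinal.mk Ms < κ) {α : Type v} (I : InvIdeal L 𝕄 Ms α)
    {s t : ℕ} (A : L.Formula (α ⊕ Fin s)) (e : Fin s → 𝕄)
    (Ψ : L.Formula (α ⊕ Fin t)) (c : Fin t → 𝕄)
    {N : ℕ} (mv : Fin N → ℕ) (Φ : ∀ i : Fin N, L.Formula (α ⊕ Fin (mv i)))
    (aa : ∀ i : Fin N, Fin (mv i) → 𝕄) (hdiv : ∀ i, IKimDivides I (Φ i) (aa i))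
    (hcoheir : FinSatIn L Ms c (Ms ∪ ⋃ i, Set.range (aa i)))
    (hent : I.mem ({x : α → 𝕄 | A.Realize (Sum.elim x e)} \
      ({x : α → 𝕄 | Ψ.Realize (Sum.elim x c)} ∪
        ⋃ i, {x : α → 𝕄 | (Φ i).Realize (Sum.elim x (aa i))}))) :
    ∃ (mm : ℕ) (e' : Fin mm → Fin s → 𝕄), 0 < mm ∧ (∀ j, EqTpOver L Ms (e' j) e) ∧
      I.mem ((⋂ j, {x : α → 𝕄 | A.Realize (Sum.elim x (e' j))}) \
        {x : α → 𝕄 | Ψ.Realize (Sum.elim x c)}) := by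
  obtain ⟨E, hE, hmem⟩ := broom_of_finset h hMs I mv Φ aa hdiv Finset.univ (Fin t) c
    {x : α → 𝕄 | Ψ.Realize (Sum.elim x c)} {x : α → 𝕄 | A.Realize (Sum.elim x e)}
    (.of_formula _ _ fun i => Or.inr ⟨i, rfl⟩) (.of_formula _ _ fun _ => Set.mem_univ _)
    (by simpa using hcoheir) (by simpa using hent)
  obtain ⟨mm, e', hmm, he', rfl⟩ := hE.exists_tuples
  exact ⟨mm, e', hmm, he', hmem⟩

end Broom

/-- **Lemma 3.3 (`𝓘`-broom lemma).** If `α(x,e) ⊢^𝓘 ψ(x,c) ∨ ⋁ᵢ φᵢ(x,aᵢ)`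
where each `φᵢ(x,aᵢ)` `𝓘`-Kim-divides over `M` and `c ⫝ᵘ_M a₁…a_N`, then
there are `e₁,…,e_m ≡_M e` with `⋀ⱼ α(x,eⱼ) ⊢^𝓘 ψ(x,c)`.  In particular,
`𝓘`-Kim-forking implies `𝓘`-quasi-dividing over `M`. -/
theorem broom_lemma (L : FirstOrder.Language.{u, u}) (𝕄 : Type u) [L.Structure 𝕄]
    (κ : Cardinal.{u}) (hmonster : IsMonster L 𝕄 κ)
    (Ms : Set 𝕄) (hMs : IsElemSubmodel L Ms) (hMssmall : Cardinal.mk Ms < κ)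
    (α : Type u) (hα : Cardinal.mk α < κ)
    (𝓘 : InvIdeal L 𝕄 Ms α)
    (s t : ℕ) (A : L.Formula (α ⊕ Fin s)) (e : Fin s → 𝕄)
    (Ψ : L.Formula (α ⊕ Fin t)) (c : Fin t → 𝕄)
    (N : ℕ) (mv : Fin N → ℕ) (Φ : ∀ i : Fin N, L.Formula (α ⊕ Fin (mv i)))
    (aa : ∀ i : Fin N, Fin (mv i) → 𝕄)
    (hdiv : ∀ i, IKimDivides 𝓘 (Φ i) (aa i))
    (hcoheir : FinSatIn L Ms c (Ms ∪ ⋃ i, Set.range (aa i)))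
    (hent : 𝓘.mem ({x : α → 𝕄 | A.Realize (Sum.elim x e)} \
      ({x : α → 𝕄 | Ψ.Realize (Sum.elim x c)} ∪
        ⋃ i, {x : α → 𝕄 | (Φ i).Realize (Sum.elim x (aa i))}))) :
    (∃ (mm : ℕ) (e' : Fin mm → Fin s → 𝕄), 0 < mm ∧ (∀ j, EqTpOver L Ms (e' j) e) ∧
      𝓘.mem ((⋂ j, {x : α → 𝕄 | A.Realize (Sum.elim x (e' j))}) \
        {x : α → 𝕄 | Ψ.Realize (Sum.elim x c)})) ∧
    ∀ (n : ℕ) (φ : L.Formula (α ⊕ Fin n)) (b : Fin n → 𝕄),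
      IKimForks 𝓘 φ b → IQuasiDivides 𝓘 φ b := by
  refine ⟨exists_conjugates_of_broom hmonster hMssmall 𝓘 A e Ψ c mv Φ aa hdiv hcoheir hent, ?_⟩
  rintro n φ b ⟨N', m', ψ, c', hψ, himp⟩
  obtain ⟨mm, b', hmm, hb', hmem⟩ := exists_conjugates_of_broom hmonster hMssmall 𝓘 φ b
    (⊥ : L.Formula (α ⊕ Fin 0)) Fin.elim0 m' ψ c' hψ
    (finSatIn_iff.2 fun _ _ ha => ⟨_, fun i => i.elim0, ha⟩) (by
      have hempty : 𝓘.mem ∅ := 𝓘.mem_of_subset (C := ∅) hent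
        (by simpa using (DefOver.univ (L := L) (C := ∅) (β := α)).compl) (Set.empty_subset _)
      convert hempty
      rw [Set.sdiff_eq_empty]
      exact fun x hx => Or.inr (Set.mem_iUnion.2 (himp x hx)))
  refine ⟨mm, b', hmm, hb', ?_⟩
  convert hmem using 1
  ext x
  simp

end NSOP2Paper
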